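/- Let V be a vector space over a field F. Then the endomorphism ring R = End_F(V) of all F-linear endomorphisms of V is a QB-ring: for all a, x, b in R with x a + b = 1 there exists y in R such that a + y b is quasi-invertible. -/

import Mathlib

/-- `x` and `y` are centrally orthogonal: `x r y = 0` and `y r x = 0` for all `r`. -/
def CentOrth {R : Type*} [Ring R] (x y : R) : Prop :=
  ∀ r : R, x * r * y = 0 ∧ y * r * x = 0

/-- `u` is quasi-invertible: `(1 - u a) ⊥ (1 - b u)` for some `a, b`. -/
def QuasiInv {R : Type*} [Ring R] (u : R) : Prop :=
  ∃ a b : R, CentOrth (1 - u * a) (1 - b * u)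

/-- `R` is a QB-ring. -/
def IsQB (R : Type*) [Ring R] : Prop :=
  ∀ a x b : R, x * a + b = 1 → ∃ y : R, QuasiInv (a + y * b)

theorem QuasiInv.of_mul_eq_one {R : Type*} [Ring R] {u v : R} (h : u * v = 1) : QuasiInv u :=
  ⟨v, 0, fun r ↦ by simp [h]⟩

theorem QuasiInv.of_mul_eq_one' {R : Type*} [Ring R] {u v : R} (h : v * u = 1) : QuasiInv u :=
  ⟨0, v, fun r ↦ by simp [h]⟩

section

universe v w

variable {F : Type*} {V : Type v} {W : Type w} [Field F] [AddCommGroup V] [Module F V]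
  [AddCommGroup W] [Module F W]

theorem Module.End.quasiInv_of_injective {u : Module.End F V} (h : Function.Injective u) :
    QuasiInv u := by
  obtain ⟨_, hv⟩ := u.exists_leftInverse_of_injective (LinearMap.ker_eq_bot.2 h)
  exact .of_mul_eq_one' hv

theorem Module.End.quasiInv_of_surjective {u : Module.End F V} (h : Function.Surjective u) :
    QuasiInv u := by
  obtain ⟨_, hv⟩ := u.exists_rightInverse_of_surjective (LinearMap.range_eq_top.2 h)
  exact .of_mul_eq_one hv

theorem LinearMap.exists_injective_or_surjective :
    ∃ f : V →ₗ[F] W, Function.Injective f ∨ Function.Surjective f := by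
  rcases le_total (Cardinal.lift.{w} (Module.rank F V)) (Cardinal.lift.{v} (Module.rank F W))
    with h | h
  · obtain ⟨f, hf⟩ := lift_rank_le_iff_exists_linearMap.1 h
    exact ⟨f, .inl hf⟩
  · obtain ⟨g, hg⟩ := lift_rank_le_iff_exists_linearMap.1 h
    obtain ⟨f, hf⟩ := g.exists_leftInverse_of_injective (LinearMap.ker_eq_bot.2 hg)
    exact ⟨f, .inr fun w ↦ ⟨g w, LinearMap.congr_fun hf w⟩⟩

end

/-- Example 3.11: the endomorphism ring of any vector space over a field is a QB-ring. -/
theorem endomorphismRing_isQB (F : Type*) [Field F] (V : Type*) [AddCommGroup V]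
    [Module F V] : IsQB (Module.End F V) := by
  intro a x b h
  have ha : ∀ k ∈ LinearMap.ker b, a k = 0 → k = 0 := fun k hk hak ↦ by
    simpa [LinearMap.mem_ker.1 hk, hak] using (LinearMap.congr_fun h k).symm
  obtain ⟨W, hW⟩ := (LinearMap.ker b).exists_isCompl
  obtain ⟨C, hC⟩ := ((LinearMap.ker b).map a).exists_isCompl
  have hbW : LinearMap.ker (b ∘ₗ W.subtype) = ⊥ := by
    refine LinearMap.ker_eq_bot'.2 fun w hw ↦ Subtype.ext ?_
    exact Submodule.disjoint_def.1 hW.disjoint w hw w.2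
  obtain ⟨g, hg⟩ := (b ∘ₗ W.subtype).exists_leftInverse_of_injective hbW
  obtain ⟨f, hf⟩ := LinearMap.exists_injective_or_surjective (F := F) (V := W) (W := C)
  let y : Module.End F V := (C.subtype ∘ₗ f - a ∘ₗ W.subtype) ∘ₗ g
  have hu (k : V) (hk : k ∈ LinearMap.ker b) (w : W) : (a + y * b) (k + w) = a k + f w := by
    have hgw : g (b w) = w := LinearMap.congr_fun hg w
    simp [y, LinearMap.mem_ker.1 hk, hgw]
  refine ⟨y, hf.elim (fun hf ↦ ?_) fun hf ↦ ?_⟩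
  · refine Module.End.quasiInv_of_injective ((injective_iff_map_eq_zero _).2 fun v hv ↦ ?_)
    obtain ⟨k, hk, w, hw, rfl⟩ := Submodule.mem_sup.1 (hW.sup_eq_top ▸ Submodule.mem_top (x := v))
    lift w to W using hw
    rw [hu k hk] at hv
    have hfw : (f w : V) = 0 := by
      refine Submodule.disjoint_def.1 hC.disjoint _ ?_ (f w).2
      rw [← neg_eq_of_add_eq_zero_right hv]
      exact neg_mem (Submodule.mem_map_of_mem hk)
    have hw0 : w = 0 := (map_eq_zero_iff f hf).1 (Subtype.ext hfw)
    have hk0 : k = 0 := ha k hk (by simpa [hfw] using hv)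
    simp [hw0, hk0]
  · refine Module.End.quasiInv_of_surjective fun v ↦ ?_
    obtain ⟨_, ⟨k, hk, rfl⟩, c, hc, rfl⟩ :=
      Submodule.mem_sup.1 (hC.sup_eq_top ▸ Submodule.mem_top (x := v))
    obtain ⟨w, hw⟩ := hf ⟨c, hc⟩
    exact ⟨k + w, by rw [hu k hk, hw]⟩
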